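/- arXiv:1804.00031 — 2 statements merged into one kernel-verified Lean document; each statement's English description precedes it below -/
import Mathlib

section
/- Let G be a finite group and let Γ₁ and Γ₂ be subgroups of G. Then Γ₁ and Γ₂ are almost conjugate in G (i.e., for every element g of G, the conjugacy class of g in G intersects Γ₁ and Γ₂ in the same number of elements) if and only if the complex permutation representations ℂ[Γ₁\G] and ℂ[Γ₂\G] afforded by the right actions of G on the right coset spaces Γ₁\G and Γ₂\G are equivalent as complex linear representations of G. -/
noncomputable section

open TensorProduct

/-- The space `Γ\G` of right cosets `Γx` of a subgroup `Γ` of a group `G`. -/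
abbrev RightCosets {G : Type*} [Group G] (Γ : Subgroup G) : Type _ :=
  Quotient (QuotientGroup.rightRel Γ)

/-- The right coset `Γx` of `x : G`. -/
def rcMk {G : Type*} [Group G] (Γ : Subgroup G) (x : G) : RightCosets Γ := Quotient.mk'' x

/-- The right action of `g ∈ G` on right cosets: `(Γx) · g = Γ(xg)`. -/
def rcSMulFun {G : Type*} [Group G] (Γ : Subgroup G) (g : G) :
    RightCosets Γ → RightCosets Γ :=
  Quotient.map' (· * g) fun x y h => by
    rw [QuotientGroup.rightRel_apply] at h ⊢
    have hxy : y * g * (x * g)⁻¹ = y * x⁻¹ := by group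
    rw [hxy]; exact h

/-- The right action of `g ∈ G` on the free module `R[Γ\G]` (on basis elements,
`(Γx) · g = Γ(xg)`). -/
def rcAct (R : Type*) [CommRing R] {G : Type*} [Group G] (Γ : Subgroup G) (g : G) :
    (RightCosets Γ →₀ R) →ₗ[R] (RightCosets Γ →₀ R) :=
  Finsupp.lmapDomain R R (rcSMulFun Γ g)

universe u
open Module

lemma finite_homA {k A : Type*} [Field k] [Ring A] [Algebra k A]
    {T M : Type*} [AddCommGroup T] [Module k T] [Module A T] [IsScalarTower k A T]
    [AddCommGroup M] [Module k M] [Module A M] [IsScalarTower k A M]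
    [FiniteDimensional k T] [FiniteDimensional k M] : FiniteDimensional k (T →ₗ[A] M) :=
  FiniteDimensional.of_injective (LinearMap.restrictScalarsₗ k A T M k)
    (LinearMap.restrictScalars_injective k)

lemma finrank_hom_prod {k A : Type*} [Field k] [Ring A] [Algebra k A]
    {T M P Q : Type*} [AddCommGroup T] [Module k T] [Module A T] [IsScalarTower k A T]
    [AddCommGroup M] [Module k M] [Module A M] [IsScalarTower k A M]
    [AddCommGroup P] [Module k P] [Module A P] [IsScalarTower k A P]
    [AddCommGroup Q] [Module k Q] [Module A Q] [IsScalarTower k A Q]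
    [FiniteDimensional k T] [FiniteDimensional k P] [FiniteDimensional k Q]
    (e : (P × Q) ≃ₗ[A] M) :
    finrank k (T →ₗ[A] M) = finrank k (T →ₗ[A] P) + finrank k (T →ₗ[A] Q) := by
  have := finite_homA (k := k) (A := A) (T := T) (M := P)
  have := finite_homA (k := k) (A := A) (T := T) (M := Q)
  rw [← finrank_prod]
  refine LinearEquiv.finrank_eq (LinearEquiv.symm
    { toFun := fun f => e.toLinearMap.comp (f.1.prod f.2)
      map_add' := ?_
      map_smul' := ?_
      invFun := fun f => ((LinearMap.fst A P Q).comp (e.symm.toLinearMap.comp f),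
        (LinearMap.snd A P Q).comp (e.symm.toLinearMap.comp f))
      left_inv := ?_
      right_inv := ?_ })
  · intro f g
    ext t
    simp [← map_add]
  · intro c f
    ext t
    have : ((c • f.1 t, c • f.2 t) : P × Q) = (algebraMap k A c) • (f.1 t, f.2 t) := by
      rw [Prod.smul_mk, algebraMap_smul, algebraMap_smul]
    change e (c • f.1 t, c • f.2 t) = c • e (f.1 t, f.2 t)
    rw [this, map_smul, algebraMap_smul]
  · intro f
    ext t <;> simp
  · intro f
    ext t
    simp

theorem semisimple_equiv_of_hom {k A : Type*} [Field k] [Ring A] [Algebra k A] (n : ℕ) :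
    ∀ (M N : Type u) [AddCommGroup M] [Module k M] [Module A M] [IsScalarTower k A M]
    [AddCommGroup N] [Module k N] [Module A N] [IsScalarTower k A N]
    [FiniteDimensional k M] [FiniteDimensional k N]
    [IsSemisimpleModule A M] [IsSemisimpleModule A N]
    (_ : ∀ (T : Type u) [AddCommGroup T] [Module k T] [Module A T] [IsScalarTower k A T]
      [FiniteDimensional k T], finrank k (T →ₗ[A] M) = finrank k (T →ₗ[A] N))
    (_ : finrank k M = n), Nonempty (M ≃ₗ[A] N) := by
  induction n using Nat.strong_induction_on with
  | _ n ih =>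
  intro M N _ _ _ _ _ _ _ _ _ _ _ _ h hn
  have := finite_homA (k := k) (A := A) (T := N) (M := N)
  rcases subsingleton_or_nontrivial M with hM | hM
  · have h1 := h N
    have : Subsingleton (N →ₗ[A] M) := ⟨fun f g => by ext; exact Subsingleton.elim _ _⟩
    rw [finrank_zero_of_subsingleton, eq_comm, finrank_zero_iff] at h1
    have : Subsingleton N := ⟨fun a b => by
      have h2 := Subsingleton.elim (LinearMap.id : N →ₗ[A] N) 0
      have ha := LinearMap.congr_fun h2 a
      have hb := LinearMap.congr_fun h2 b
      simp at ha hb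
      rw [ha, hb]⟩
    exact ⟨0⟩
  · obtain ⟨S, hS⟩ := IsSemisimpleModule.exists_simple_submodule A M
    have : Nontrivial S := IsSimpleModule.nontrivial A S
    have : FiniteDimensional k S := FiniteDimensional.of_injective (S.subtype.restrictScalars k)
      Subtype.val_injective
    have := finite_homA (k := k) (A := A) (T := S) (M := N)
    have := finite_homA (k := k) (A := A) (T := S) (M := M)
    have hSM : Nontrivial (S →ₗ[A] M) := ⟨S.subtype, 0, fun h0 => by
      obtain ⟨x, hx⟩ := exists_ne (0 : S)
      apply hx
      have := LinearMap.congr_fun h0 x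
      simpa using this⟩
    have hSN : 0 < finrank k (S →ₗ[A] N) := by
      rw [← h S]; exact finrank_pos
    rw [finrank_pos_iff] at hSN
    obtain ⟨f, hf⟩ := exists_ne (0 : S →ₗ[A] N)
    have hfi := LinearMap.injective_of_ne_zero hf
    obtain ⟨M', hM'⟩ := exists_isCompl S
    obtain ⟨N', hN'⟩ := exists_isCompl (LinearMap.range f)
    have : FiniteDimensional k M' := FiniteDimensional.of_injective (M'.subtype.restrictScalars k)
      Subtype.val_injective
    have : FiniteDimensional k N' := FiniteDimensional.of_injective (N'.subtype.restrictScalars k)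
      Subtype.val_injective
    let e1 : (S × M') ≃ₗ[A] M := Submodule.prodEquivOfIsCompl S M' hM'
    let e2 : (S × N') ≃ₗ[A] N :=
      ((LinearEquiv.ofInjective f hfi).prodCongr (LinearEquiv.refl A N')).trans
        (Submodule.prodEquivOfIsCompl _ N' hN')
    have hd : finrank k M = finrank k S + finrank k M' := by
      rw [← finrank_prod]
      exact ((e1.restrictScalars k).finrank_eq).symm
    have hSpos : 0 < finrank k S := finrank_pos
    obtain ⟨e⟩ := ih (finrank k M') (by omega) M' N' (fun T => by
      intro _ _ _ _ _
      have := h T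
      rw [finrank_hom_prod e1, finrank_hom_prod e2] at this
      omega) rfl
    exact ⟨e1.symm.trans (((LinearEquiv.refl A S).prodCongr e).trans e2)⟩

open scoped MonoidAlgebra in
theorem equiv_of_char {k G : Type*} [Field k] [CharZero k] [Group G] [Finite G]
    {V W : Type u} [AddCommGroup V] [Module k V] [AddCommGroup W] [Module k W]
    [FiniteDimensional k V] [FiniteDimensional k W]
    (ρ : Representation k G V) (σ : Representation k G W)
    (h : ρ.character = σ.character) :
    ∃ e : V ≃ₗ[k] W, ∀ g v, e (ρ g v) = σ g (e v) := by
  have := Fintype.ofFinite G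
  have hne : (Nat.card G : k) ≠ 0 := by simp [Nat.card_eq_fintype_card]
  have : Invertible (Nat.card G : k) := invertibleOfNonzero hne
  have : NeZero (Nat.card G : k) := ⟨hne⟩
  let _ : AddCommGroup ρ.asModule := inferInstanceAs (AddCommGroup V)
  let _ : AddCommGroup σ.asModule := inferInstanceAs (AddCommGroup W)
  have key (T : Type u) [AddCommGroup T] [Module k T] [Module k[G] T] [IsScalarTower k k[G] T]
      [FiniteDimensional k T] {U : Type u} [AddCommGroup U] [Module k U] [FiniteDimensional k U]
      (π : Representation k G U) :
      finrank k (T →ₗ[k[G]] π.asModule) =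
        finrank k (Representation.IntertwiningMap
          (Representation.ofModule' T : Representation k G T) π) := by
    set τ : Representation k G T := Representation.ofModule' T with hτ
    have hτs (a : k[G]) (x : T) : τ.asAlgebraHom a x = a • x := by
      simp [hτ, Representation.ofModule', Representation.asAlgebraHom]
    refine LinearEquiv.finrank_eq ?_
    let E : τ.asModule ≃ₗ[k[G]] T :=
      { τ.asModuleEquiv with
        map_smul' := fun a x => by
          have := τ.asModuleEquiv_map_smul a x
          rw [hτs] at this
          exact this }
    let F : (T →ₗ[k[G]] π.asModule) ≃ₗ[k] (τ.asModule →ₗ[k[G]] π.asModule) :=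
    { toFun := fun f => f.comp E.toLinearMap
      map_add' := fun f g => by ext; simp
      map_smul' := fun c f => by ext; simp
      invFun := fun f => f.comp E.symm.toLinearMap
      left_inv := fun f => by ext; simp
      right_inv := fun f => by ext; simp }
    exact F.trans (Representation.IntertwiningMap.equivLinearMapAsModule τ π).symm
  obtain ⟨e⟩ := semisimple_equiv_of_hom (k := k) (A := k[G]) _ ρ.asModule σ.asModule (by
    intro T _ _ _ _ _
    rw [key T ρ, key T σ]
    have h1 := Representation.card_inv_mul_sum_char_mul_char_eq_finrank
      (Representation.ofModule' T : Representation k G T) ρ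
    rw [h, Representation.card_inv_mul_sum_char_mul_char_eq_finrank] at h1
    exact_mod_cast h1.symm) rfl
  refine ⟨ρ.asModuleEquiv.symm.trans ((e.restrictScalars k).trans σ.asModuleEquiv), ?_⟩
  intro g v
  simp [Representation.asModuleEquiv_symm_map_rho, -Representation.single_smul]

section counting

variable {G : Type*} [Group G] (Γ : Subgroup G)

lemma rcMk_eq_iff (x y : G) : rcMk Γ x = rcMk Γ y ↔ y * x⁻¹ ∈ Γ := by
  unfold rcMk
  rw [Quotient.eq'', QuotientGroup.rightRel_apply]

lemma rcSMulFun_mk (g x : G) : rcSMulFun Γ g (rcMk Γ x) = rcMk Γ (x * g) := rfl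

lemma rcMk_surj (q : RightCosets Γ) : ∃ x, rcMk Γ x = q := Quotient.exists_rep q

lemma rc_fixed_iff (g x : G) : rcSMulFun Γ g (rcMk Γ x) = rcMk Γ x ↔ x * g * x⁻¹ ∈ Γ := by
  rw [rcSMulFun_mk, eq_comm, rcMk_eq_iff]

lemma count_fixed (g : G) :
    Nat.card Γ * Nat.card {q : RightCosets Γ // rcSMulFun Γ g q = q} =
      Nat.card {x : G // x * g * x⁻¹ ∈ Γ} := by
  choose r hr using rcMk_surj Γ
  rw [← Nat.card_prod]
  have hmk (γ : Γ) (q : RightCosets Γ) : rcMk Γ (γ * r q) = q := by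
    conv_rhs => rw [← hr q]
    rw [eq_comm, rcMk_eq_iff]
    simp
  refine Nat.card_congr (Equiv.ofBijective (fun p => ⟨(p.1 : G) * r p.2.1, ?_⟩) ⟨?_, ?_⟩)
  · rw [← rc_fixed_iff, hmk]
    exact p.2.2
  · rintro ⟨γ, q, hq⟩ ⟨γ', q', hq'⟩ h
    simp only [Subtype.mk.injEq] at h
    have hqq : q = q' := by rw [← hmk γ q, h, hmk]
    subst hqq
    have := mul_right_cancel h
    simp [Subtype.ext this]
  · rintro ⟨x, hx⟩
    have h1 := (rcMk_eq_iff Γ _ _).1 (hr (rcMk Γ x))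
    refine ⟨(⟨_, h1⟩, ⟨rcMk Γ x, (rc_fixed_iff Γ g x).2 hx⟩), ?_⟩
    simp

lemma count_conj (g : G) :
    Nat.card (Subgroup.centralizer {g}) * Nat.card {x : G // x ∈ Γ ∧ IsConj g x} =
      Nat.card {x : G // x * g * x⁻¹ ∈ Γ} := by
  have h0 : ∀ y : {x : G // x ∈ Γ ∧ IsConj g x}, ∃ c, c * g * c⁻¹ = y.1 :=
    fun y => isConj_iff.1 y.2.2
  choose r hr using h0
  have hc (c : Subgroup.centralizer {g}) : (c : G) * g = g * c :=
    Subgroup.mem_centralizer_singleton_iff.1 c.2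
  have hmk (c : Subgroup.centralizer {g}) (y) : (r y * c) * g * (r y * c)⁻¹ = y.1 := by
    rw [← hr y, mul_assoc (r y), hc]
    group
  rw [← Nat.card_prod]
  refine Nat.card_congr (Equiv.ofBijective (fun p => ⟨r p.2 * (p.1 : G), ?_⟩) ⟨?_, ?_⟩)
  · rw [hmk]; exact p.2.2.1
  · rintro ⟨c, y⟩ ⟨c', y'⟩ h
    simp only [Subtype.mk.injEq] at h
    have hyy : y = y' := by
      apply Subtype.ext
      rw [← hmk c y, h, hmk]
    subst hyy
    have := mul_left_cancel h
    simp [Subtype.ext this]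
  · rintro ⟨x, hx⟩
    let y : {x : G // x ∈ Γ ∧ IsConj g x} := ⟨x * g * x⁻¹, hx, isConj_iff.2 ⟨x, rfl⟩⟩
    have hy : r y * g * (r y)⁻¹ = x * g * x⁻¹ := hr y
    refine ⟨(⟨(r y)⁻¹ * x, ?_⟩, y), ?_⟩
    · rw [Subgroup.mem_centralizer_singleton_iff]
      calc (r y)⁻¹ * x * g = (r y)⁻¹ * (x * g * x⁻¹) * x := by group
        _ = g * ((r y)⁻¹ * x) := by rw [← hy]; group
    · simp

lemma trace_rcAct [Finite G] (g : G) :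
    LinearMap.trace ℂ _ (rcAct ℂ Γ g) =
      (Nat.card {q : RightCosets Γ // rcSMulFun Γ g q = q} : ℂ) := by
  classical
  have := Fintype.ofFinite (RightCosets Γ)
  rw [LinearMap.trace_eq_matrix_trace ℂ (Finsupp.basisSingleOne (R := ℂ) (ι := RightCosets Γ)),
    Matrix.trace, Nat.card_eq_fintype_card, Fintype.card_subtype]
  simp [LinearMap.toMatrix_apply, rcAct, Finsupp.single_apply]

lemma card_eq_sum_conj [Finite G] [Fintype (ConjClasses G)] :
    Nat.card Γ = ∑ c : ConjClasses G, Nat.card {x : G // x ∈ Γ ∧ IsConj c.out x} := by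
  rw [← Nat.card_sigma]
  refine Nat.card_congr (Equiv.symm (Equiv.ofBijective (fun p => ⟨p.2.1, p.2.2.1⟩) ⟨?_, ?_⟩))
  · rintro ⟨c, x, hx, hc⟩ ⟨c', x', hx', hc'⟩ h
    simp only [Subtype.mk.injEq] at h
    subst h
    have : c = c' := by
      rw [← Quotient.out_eq c, ← Quotient.out_eq c']
      exact Quotient.sound (hc.trans hc'.symm)
    subst this
    rfl
  · rintro ⟨x, hx⟩
    exact ⟨⟨ConjClasses.mk x, x, hx, Quotient.exact (Quotient.out_eq (ConjClasses.mk x))⟩, rfl⟩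

/-- The left representation attached to the right action. -/
def rcRep : Representation ℂ G (RightCosets Γ →₀ ℂ) where
  toFun g := rcAct ℂ Γ g⁻¹
  map_one' := by
    have : rcSMulFun Γ (1 : G)⁻¹ = id := by
      funext q
      obtain ⟨x, rfl⟩ := rcMk_surj Γ q
      simp [rcSMulFun_mk]
    unfold rcAct
    rw [this, Finsupp.lmapDomain_id]
    rfl
  map_mul' g h := by
    have : rcSMulFun Γ (g * h)⁻¹ = rcSMulFun Γ g⁻¹ ∘ rcSMulFun Γ h⁻¹ := by
      funext q
      obtain ⟨x, rfl⟩ := rcMk_surj Γ q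
      simp [rcSMulFun_mk, mul_assoc]
    unfold rcAct
    rw [this, Finsupp.lmapDomain_comp]
    rfl

end counting

/-- Two subgroups `Γ₁, Γ₂` of a finite group `G` are almost conjugate
(each conjugacy class of `G` meets `Γ₁` and `Γ₂` in the same number of elements) if and
only if the complex permutation representations `ℂ[Γ₁\G]` and `ℂ[Γ₂\G]` afforded by the
right actions of `G` on the right coset spaces are equivalent. -/
theorem almostConjugate_iff_permutation_reps_equivalent
    {G : Type*} [Group G] [Finite G] (Γ₁ Γ₂ : Subgroup G) :
    (∀ g : G, Nat.card {x : G // x ∈ Γ₁ ∧ IsConj g x}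
      = Nat.card {x : G // x ∈ Γ₂ ∧ IsConj g x}) ↔
    ∃ e : (RightCosets Γ₁ →₀ ℂ) ≃ₗ[ℂ] (RightCosets Γ₂ →₀ ℂ),
      ∀ (g : G) (v : RightCosets Γ₁ →₀ ℂ),
        e (rcAct ℂ Γ₁ g v) = rcAct ℂ Γ₂ g (e v) := by
  classical
  have := Fintype.ofFinite (ConjClasses G)
  have hpos (Γ : Subgroup G) : 0 < Nat.card Γ := Nat.card_pos
  constructor
  · intro h
    have hcard : Nat.card Γ₁ = Nat.card Γ₂ := by
      rw [card_eq_sum_conj, card_eq_sum_conj]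
      exact Finset.sum_congr rfl fun c _ => h _
    obtain ⟨e, he⟩ := equiv_of_char (rcRep Γ₁) (rcRep Γ₂) (by
      funext g
      change LinearMap.trace ℂ _ (rcAct ℂ Γ₁ g⁻¹) = LinearMap.trace ℂ _ (rcAct ℂ Γ₂ g⁻¹)
      rw [trace_rcAct, trace_rcAct]
      congr 1
      apply Nat.eq_of_mul_eq_mul_left (hpos Γ₁)
      rw [count_fixed, ← count_conj, h, count_conj, ← count_fixed, hcard])
    refine ⟨e, fun g v => ?_⟩
    have := he g⁻¹ v
    simpa [rcRep] using this
  · rintro ⟨e, he⟩ g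
    have hfix (g : G) : Nat.card {q : RightCosets Γ₁ // rcSMulFun Γ₁ g q = q} =
        Nat.card {q : RightCosets Γ₂ // rcSMulFun Γ₂ g q = q} := by
      have h1 : rcAct ℂ Γ₂ g = e.conj (rcAct ℂ Γ₁ g) := by
        apply LinearMap.ext
        intro v
        rw [LinearEquiv.conj_apply_apply, he, LinearEquiv.apply_symm_apply]
      have h2 := LinearMap.trace_conj' (rcAct ℂ Γ₁ g) e
      rw [← h1, trace_rcAct, trace_rcAct] at h2
      exact_mod_cast h2.symm
    have hcard : Nat.card Γ₁ = Nat.card Γ₂ := by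
      have h1 := count_fixed Γ₁ 1
      have h2 := count_fixed Γ₂ 1
      have h3 : Nat.card {x : G // x * 1 * x⁻¹ ∈ Γ₁} = Nat.card {x : G // x * 1 * x⁻¹ ∈ Γ₂} := by
        simp
      rw [← h1, ← h2, ← hfix] at h3
      refine Nat.eq_of_mul_eq_mul_right ?_ h3
      have : Nonempty {q : RightCosets Γ₁ // rcSMulFun Γ₁ 1 q = q} :=
        ⟨rcMk Γ₁ 1, by simp [rcSMulFun_mk]⟩
      exact Nat.card_pos
    apply Nat.eq_of_mul_eq_mul_left (hpos (Subgroup.centralizer {g}))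
    rw [count_conj, count_conj, ← count_fixed, ← count_fixed, hfix, hcard]
end
end

section
/- Let G be a finite group and let Γ₁ and Γ₂ be subgroups of G such that the complex permutation representations ℂ[Γ₁\G] and ℂ[Γ₂\G] are equivalent as right ℂ[G]-modules. Then there exist right ℤ[G]-module maps τ : ℤ[Γ₁\G] → ℤ[Γ₂\G] and σ : ℤ[Γ₂\G] → ℤ[Γ₁\G] and a positive integer N such that σ ∘ τ is multiplication by N on ℤ[Γ₁\G] and τ ∘ σ is multiplication by N on ℤ[Γ₂\G]. -/
noncomputable section

open TensorProduct

theorem rcSMulFun_bij {G : Type*} [Group G] (Γ : Subgroup G) (g : G) :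
    Function.Bijective (rcSMulFun Γ g) := by
  refine Function.bijective_iff_has_inverse.2 ⟨rcSMulFun Γ g⁻¹, ?_, ?_⟩
  · intro x
    induction x using Quotient.inductionOn' with
    | h x => simp [rcSMulFun]
  · intro x
    induction x using Quotient.inductionOn' with
    | h x => simp [rcSMulFun]

theorem rcSMulFun_mul {G : Type*} [Group G] (Γ : Subgroup G) (g k : G) (x : RightCosets Γ) :
    rcSMulFun Γ k (rcSMulFun Γ g x) = rcSMulFun Γ (g * k) x := by
  induction x using Quotient.inductionOn' with
  | h x => simp [rcSMulFun, mul_assoc]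

theorem rcAct_apply (R : Type*) [CommRing R] {G : Type*} [Group G] (Γ : Subgroup G) (g : G)
    (v : RightCosets Γ →₀ R) (x : RightCosets Γ) :
    rcAct R Γ g v (rcSMulFun Γ g x) = v x := by
  simp only [rcAct, Finsupp.lmapDomain_apply]
  exact Finsupp.mapDomain_apply (rcSMulFun_bij Γ g).1 v x

theorem rcAct_single (R : Type*) [CommRing R] {G : Type*} [Group G] (Γ : Subgroup G) (g : G)
    (x : RightCosets Γ) (r : R) :
    rcAct R Γ g (Finsupp.single x r) = Finsupp.single (rcSMulFun Γ g x) r := by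
  simp [rcAct, Finsupp.mapDomain_single]

/-- Integral generic-determinant argument, for invariant matrices. -/
theorem exists_int_matrix {G X Y : Type*} [Group G] [Fintype G] [Fintype X] [DecidableEq X]
    (a : G → X → X) (b : G → Y → Y) (f : X ≃ Y)
    (B : Y → X → ℂ) (hB : ∀ g y x, B (b g y) (a g x) = B y x)
    (hdet : (Matrix.of fun i j => B (f i) j).det ≠ 0) :
    ∃ c : Y × X → ℤ, (Matrix.of fun i j => ∑ g : G, c (b g (f i), a g j)).det ≠ 0 := by
  by_contra! hc
  set M : Matrix X X (MvPolynomial (Y × X) ℤ) :=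
    Matrix.of fun i j => ∑ g : G, MvPolynomial.X (b g (f i), a g j) with hM
  have hP : M.det = 0 := by
    apply MvPolynomial.funext
    intro c
    rw [RingHom.map_det, map_zero, ← hc c]
    congr 1
    ext i j
    simp [hM]
  have h2 := congrArg (MvPolynomial.eval₂Hom (Int.castRingHom ℂ) (fun p : Y × X => B p.1 p.2)) hP
  rw [RingHom.map_det, map_zero] at h2
  have h3 : (MvPolynomial.eval₂Hom (Int.castRingHom ℂ)
      (fun p : Y × X => B p.1 p.2)).mapMatrix M =
      (Fintype.card G : ℂ) • (Matrix.of fun i j => B (f i) j) := by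
    ext i j
    simp [hM, hB]
  rw [h3, Matrix.det_smul] at h2
  rcases mul_eq_zero.1 h2 with h4 | h4
  · have := eq_zero_of_pow_eq_zero h4
    simp at this
  · exact hdet h4

/-- If the complex permutation representations `ℂ[Γ₁\G]` and `ℂ[Γ₂\G]`
are equivalent as right `ℂ[G]`-modules, then there are right `ℤ[G]`-module maps
`τ : ℤ[Γ₁\G] → ℤ[Γ₂\G]` and `σ : ℤ[Γ₂\G] → ℤ[Γ₁\G]` and a positive integer `N`
with `σ ∘ τ = N·id` and `τ ∘ σ = N·id`. -/
theorem exists_integral_transplantation_maps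
    {G : Type*} [Group G] [Finite G] (Γ₁ Γ₂ : Subgroup G)
    (h : ∃ e : (RightCosets Γ₁ →₀ ℂ) ≃ₗ[ℂ] (RightCosets Γ₂ →₀ ℂ),
      ∀ (g : G) (v : RightCosets Γ₁ →₀ ℂ),
        e (rcAct ℂ Γ₁ g v) = rcAct ℂ Γ₂ g (e v)) :
    ∃ (τ : (RightCosets Γ₁ →₀ ℤ) →ₗ[ℤ] (RightCosets Γ₂ →₀ ℤ))
      (σ : (RightCosets Γ₂ →₀ ℤ) →ₗ[ℤ] (RightCosets Γ₁ →₀ ℤ)) (N : ℕ),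
      0 < N ∧
      (∀ g : G, τ ∘ₗ rcAct ℤ Γ₁ g = rcAct ℤ Γ₂ g ∘ₗ τ) ∧
      (∀ g : G, σ ∘ₗ rcAct ℤ Γ₂ g = rcAct ℤ Γ₁ g ∘ₗ σ) ∧
      σ ∘ₗ τ = (N : ℤ) • LinearMap.id ∧
      τ ∘ₗ σ = (N : ℤ) • LinearMap.id := by
  classical
  obtain ⟨e, he⟩ := h
  haveI := Fintype.ofFinite G
  haveI : Fintype (RightCosets Γ₁) := Fintype.ofFinite _
  haveI : Fintype (RightCosets Γ₂) := Fintype.ofFinite _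
  have hcard : Fintype.card (RightCosets Γ₁) = Fintype.card (RightCosets Γ₂) := by
    have := e.finrank_eq
    simpa using this
  let f : RightCosets Γ₁ ≃ RightCosets Γ₂ := Fintype.equivOfCardEq hcard
  let b₁ : Module.Basis (RightCosets Γ₁) ℂ (RightCosets Γ₁ →₀ ℂ) := Finsupp.basisSingleOne
  let b₂ : Module.Basis (RightCosets Γ₂) ℂ (RightCosets Γ₂ →₀ ℂ) := Finsupp.basisSingleOne
  have hdet : (Matrix.of fun i j => e (Finsupp.single j 1) (f i)).det ≠ 0 := by
    have h1 : LinearMap.toMatrix b₁ b₂ e.toLinearMap * LinearMap.toMatrix b₂ b₁ e.symm.toLinearMap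
        = 1 := by
      rw [← LinearMap.toMatrix_comp]
      simp
    have h2 : (Matrix.of fun i j => e (Finsupp.single j 1) (f i)) =
        (LinearMap.toMatrix b₁ b₂ e.toLinearMap).submatrix f (Equiv.refl _) := by
      ext i j
      simp [LinearMap.toMatrix_apply, b₁, b₂]
    have h3 : (Matrix.of fun i j => e (Finsupp.single j 1) (f i)) *
        (LinearMap.toMatrix b₂ b₁ e.symm.toLinearMap).submatrix (Equiv.refl _) f = 1 := by
      rw [h2, Matrix.submatrix_mul_equiv, h1, Matrix.submatrix_one_equiv]
    intro h0
    have := congrArg Matrix.det h3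
    rw [Matrix.det_mul, h0] at this
    simp at this
  obtain ⟨c, hc⟩ := exists_int_matrix (fun g : G => rcSMulFun Γ₁ g) (fun g : G => rcSMulFun Γ₂ g) f
    (fun y x => e (Finsupp.single x 1) y)
    (by
      intro g y x
      change e (Finsupp.single (rcSMulFun Γ₁ g x) 1) (rcSMulFun Γ₂ g y) = _
      rw [← rcAct_single, he, rcAct_apply]) hdet
  set A : Matrix (RightCosets Γ₁) (RightCosets Γ₁) ℤ :=
    Matrix.of fun i j => ∑ g : G, c (rcSMulFun Γ₂ g (f i), rcSMulFun Γ₁ g j) with hA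
  change A.det ≠ 0 at hc
  let B : Matrix (RightCosets Γ₂) (RightCosets Γ₁) ℤ := A.submatrix f.symm (Equiv.refl _)
  let S : Matrix (RightCosets Γ₁) (RightCosets Γ₂) ℤ :=
    A.det • A.adjugate.submatrix (Equiv.refl _) f.symm
  have hBS : B * S = (A.det * A.det) • (1 : Matrix _ _ ℤ) := by
    simp only [B, S]
    rw [Matrix.mul_smul, Matrix.submatrix_mul_equiv, Matrix.mul_adjugate, Matrix.submatrix_smul,
      Pi.smul_apply, Pi.smul_apply, Matrix.submatrix_one_equiv, smul_smul]
  have hSB : S * B = (A.det * A.det) • (1 : Matrix _ _ ℤ) := by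
    simp only [B, S]
    rw [Matrix.smul_mul, Matrix.submatrix_mul_equiv, Matrix.adjugate_mul, Matrix.submatrix_smul,
      Pi.smul_apply, Pi.smul_apply, Matrix.submatrix_one_equiv, smul_smul]
  have hB : ∀ g y x, B (rcSMulFun Γ₂ g y) (rcSMulFun Γ₁ g x) = B y x := by
    intro g y x
    simp only [B, hA, Matrix.submatrix_apply, Matrix.of_apply, Equiv.apply_symm_apply,
      Equiv.refl_apply, rcSMulFun_mul]
    exact Fintype.sum_equiv (Equiv.mulLeft g) _ _ (fun k => rfl)
  let β₁ : Module.Basis (RightCosets Γ₁) ℤ (RightCosets Γ₁ →₀ ℤ) := Finsupp.basisSingleOne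
  let β₂ : Module.Basis (RightCosets Γ₂) ℤ (RightCosets Γ₂ →₀ ℤ) := Finsupp.basisSingleOne
  let τ := Matrix.toLin β₁ β₂ B
  let σ := Matrix.toLin β₂ β₁ S
  have hN : (((A.det * A.det).natAbs : ℕ) : ℤ) = A.det * A.det :=
    Int.natAbs_of_nonneg (mul_self_nonneg _)
  have hd : A.det * A.det ≠ 0 := mul_ne_zero hc hc
  have hστ : σ ∘ₗ τ = (A.det * A.det) • LinearMap.id := by
    simp only [σ, τ]
    rw [← Matrix.toLin_mul, hSB, map_smul, Matrix.toLin_one]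
  have hτσ : τ ∘ₗ σ = (A.det * A.det) • LinearMap.id := by
    simp only [σ, τ]
    rw [← Matrix.toLin_mul, hBS, map_smul, Matrix.toLin_one]
  have hτB : ∀ x y, τ (Finsupp.single x 1) y = B y x := by
    intro x y
    have h1 : LinearMap.toMatrix β₁ β₂ τ y x = B y x := by
      simp only [τ, LinearMap.toMatrix_toLin]
    rw [← h1]
    simp [LinearMap.toMatrix_apply, β₁, β₂]
  have hτ : ∀ g : G, τ ∘ₗ rcAct ℤ Γ₁ g = rcAct ℤ Γ₂ g ∘ₗ τ := by
    intro g
    refine β₁.ext fun x => ?_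
    ext y
    obtain ⟨y, rfl⟩ := (rcSMulFun_bij Γ₂ g).2 y
    have hx : β₁ x = Finsupp.single x 1 := by simp [β₁]
    rw [hx, LinearMap.comp_apply, LinearMap.comp_apply, rcAct_apply, rcAct_single, hτB, hτB, hB]
  refine ⟨τ, σ, (A.det * A.det).natAbs, Int.natAbs_pos.2 hd, hτ, ?_, ?_, ?_⟩
  · intro g
    refine LinearMap.ext fun v => ?_
    have h1 : ∀ w, σ (τ w) = (A.det * A.det) • w := fun w => LinearMap.congr_fun hστ w
    have h2 : ∀ w, τ (σ w) = (A.det * A.det) • w := fun w => LinearMap.congr_fun hτσ w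
    have h3 : ∀ w, τ (rcAct ℤ Γ₁ g w) = rcAct ℤ Γ₂ g (τ w) := fun w => LinearMap.congr_fun (hτ g) w
    have h4 := congrArg σ (h3 (σ v))
    rw [h1, h2, map_smul, map_smul] at h4
    exact (smul_right_injective _ hd h4).symm
  · rw [hN]; exact hστ
  · rw [hN]; exact hτσ
end
end
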